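/- arXiv:1407.7745 — 2 statements merged into one kernel-verified Lean document; each statement's English description precedes it below -/
import Mathlib

section
/- Let G be a group and H ≤ G a subgroup of finite index. If there exists an injective group homomorphism φ : H → Homeo(C) such that φ(h) is a prefix-exchange homeomorphism for every h ∈ H, then there exists an injective group homomorphism ψ : G → Homeo(C) such that ψ(g) is a prefix-exchange homeomorphism for every g ∈ G. (In other words, if H embeds in Thompson's group V and [G:H] < ∞, then G embeds in Thompson's group V.) -/
/-- The Cantor space `C = ℕ → Bool` with the product topology. -/
abbrev Cantor : Type := ℕ → Bool

/-- The sequence `u · y` beginning with the letters of the finite word `u` and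
continuing with `y`. -/
def appendSeq (u : List Bool) (y : Cantor) : Cantor :=
  fun n => if h : n < u.length then u.get ⟨n, h⟩ else y (n - u.length)

/-- The cylinder `u*`: all sequences of the form `u · y`. -/
def cylinder (u : List Bool) : Set Cantor :=
  Set.range (appendSeq u)

/-- The group of homeomorphisms of the Cantor space, with composition as
multiplication (`(f * g) x = f (g x)`). -/
instance : Group (Cantor ≃ₜ Cantor) where
  mul f g := g.trans f
  one := Homeomorph.refl _
  inv := Homeomorph.symm
  mul_assoc _ _ _ := Homeomorph.ext fun _ => rfl
  one_mul _ := Homeomorph.ext fun _ => rfl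
  mul_one _ := Homeomorph.ext fun _ => rfl
  inv_mul_cancel f := Homeomorph.ext fun x => f.symm_apply_apply x

/-- A homeomorphism of the Cantor space is a prefix-exchange homeomorphism if it is
given by finitely many prefix substitutions `uᵢ · y ↦ vᵢ · y`, where the cylinders
`uᵢ*` partition `C` and the cylinders `vᵢ*` partition `C`. -/
def IsPrefixExchange (f : Cantor ≃ₜ Cantor) : Prop :=
  ∃ n : ℕ, 1 ≤ n ∧ ∃ u v : Fin n → List Bool,
    (Set.univ : Set (Fin n)).PairwiseDisjoint (fun i => cylinder (u i)) ∧
    (⋃ i, cylinder (u i)) = Set.univ ∧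
    (Set.univ : Set (Fin n)).PairwiseDisjoint (fun i => cylinder (v i)) ∧
    (⋃ i, cylinder (v i)) = Set.univ ∧
    ∀ (i : Fin n) (y : Cantor), f (appendSeq (u i) y) = appendSeq (v i) y


theorem appendSeq_nil (y : Cantor) : appendSeq [] y = y := by
  funext n
  simp [appendSeq]

theorem appendSeq_append (u v : List Bool) (y : Cantor) :
    appendSeq (u ++ v) y = appendSeq u (appendSeq v y) := by
  funext n
  simp only [appendSeq, List.get_eq_getElem, List.length_append]
  split_ifs with h₁ h₂ h₃ h₃
  · rw [List.getElem_append_left h₂]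
  · rw [List.getElem_append_right (by omega)]
  · omega
  · omega
  · omega
  · congr 1
    omega

theorem appendSeq_apply_add (u : List Bool) (y : Cantor) (n : ℕ) :
    appendSeq u y (u.length + n) = y n := by
  simp [appendSeq]

theorem appendSeq_injective (u : List Bool) : Function.Injective (appendSeq u) := by
  intro y z h
  funext n
  rw [← appendSeq_apply_add u y, h, appendSeq_apply_add]

theorem continuous_appendSeq (u : List Bool) : Continuous (appendSeq u) := by
  refine continuous_pi fun n => ?_
  by_cases h : n < u.length
  · simp only [appendSeq, h, dite_true]
    exact continuous_const
  · simp only [appendSeq, h, dite_false]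
    exact continuous_apply _

/-- A family of words is a complete prefix code if every sequence starts with exactly one
of the words, counted with multiplicity. -/
def IsCompletePrefixCode {ι : Type*} (u : ι → List Bool) : Prop :=
  Function.Bijective fun p : ι × Cantor => appendSeq (u p.1) p.2

theorem isCompletePrefixCode_iff {ι : Type*} (u : ι → List Bool) :
    IsCompletePrefixCode u ↔
      (Set.univ : Set ι).PairwiseDisjoint (fun i => cylinder (u i)) ∧
        (⋃ i, cylinder (u i)) = Set.univ := by
  constructor
  · rintro ⟨hinj, hsurj⟩
    refine ⟨fun i _ j _ hij => ?_, Set.eq_univ_of_forall fun x => ?_⟩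
    · refine Set.disjoint_left.2 ?_
      rintro _ ⟨y, rfl⟩ ⟨z, hz⟩
      exact hij (congrArg Prod.fst (@hinj (j, z) (i, y) hz)).symm
    · obtain ⟨⟨i, y⟩, h⟩ := hsurj x
      exact Set.mem_iUnion.2 ⟨i, y, h⟩
  · rintro ⟨hdisj, hcover⟩
    refine ⟨?_, fun x => ?_⟩
    · rintro ⟨i, y⟩ ⟨j, z⟩ h
      have hij : i = j := by
        by_contra hij
        exact Set.disjoint_left.1 (hdisj (Set.mem_univ i) (Set.mem_univ j) hij)
          ⟨y, rfl⟩ ⟨z, h.symm⟩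
      subst hij
      exact congrArg (Prod.mk i) (appendSeq_injective _ h)
    · obtain ⟨i, y, h⟩ := Set.mem_iUnion.1 (hcover ▸ Set.mem_univ x)
      exact ⟨(i, y), h⟩

theorem IsCompletePrefixCode.comp_equiv {ι κ : Type*} {u : ι → List Bool}
    (hu : IsCompletePrefixCode u) (e : κ ≃ ι) : IsCompletePrefixCode (u ∘ e) :=
  Function.Bijective.comp hu (e.prodCongr (Equiv.refl Cantor)).bijective

theorem isCompletePrefixCode_nil {ι : Type*} [Unique ι] :
    IsCompletePrefixCode fun _ : ι => [] := by
  simp only [IsCompletePrefixCode, appendSeq_nil]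
  exact (Equiv.uniqueProd Cantor ι).bijective

/-- Substituting complete prefix codes for the tails of a complete prefix code. -/
theorem IsCompletePrefixCode.sigma {ι : Type*} {κ : ι → Type*} {w : ι → List Bool}
    {u : ∀ i, κ i → List Bool} (hw : IsCompletePrefixCode w)
    (hu : ∀ i, IsCompletePrefixCode (u i)) :
    IsCompletePrefixCode fun p : Σ i, κ i => w p.1 ++ u p.1 p.2 := by
  refine ⟨?_, fun x => ?_⟩
  · rintro ⟨⟨i, a⟩, y⟩ ⟨⟨j, b⟩, z⟩ h
    simp only [appendSeq_append] at h
    have h' := @hw.1 (i, _) (j, _) h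
    obtain rfl : i = j := congrArg Prod.fst h'
    have h'' := @(hu i).1 (a, y) (b, z) (congrArg Prod.snd h')
    cases h''
    rfl
  · obtain ⟨⟨i, x'⟩, rfl⟩ := hw.2 x
    obtain ⟨⟨a, y⟩, rfl⟩ := (hu i).2 x'
    exact ⟨(⟨i, a⟩, y), appendSeq_append _ _ _⟩

theorem IsCompletePrefixCode.option {ι : Type*} {w : ι → List Bool}
    (hw : IsCompletePrefixCode w) :
    IsCompletePrefixCode fun o : Option ι => o.elim [false] fun i => true :: w i := by
  have hcons (i : ι) (y : Cantor) :
      appendSeq (true :: w i) y = appendSeq [true] (appendSeq (w i) y) :=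
    appendSeq_append [true] (w i) y
  have hhead (b : Bool) (y : Cantor) : appendSeq [b] y 0 = b := by simp [appendSeq]
  refine ⟨?_, fun x => ?_⟩
  · rintro ⟨_ | i, y⟩ ⟨_ | j, z⟩ h
    · exact congrArg (Prod.mk none) (appendSeq_injective _ h)
    · simp only [Option.elim, hcons] at h
      simpa [hhead] using congrFun h 0
    · simp only [Option.elim, hcons] at h
      simpa [hhead] using congrFun h 0
    · simp only [Option.elim, hcons] at h
      cases @hw.1 (i, y) (j, z) (appendSeq_injective _ h)
      rfl
  · have hx : appendSeq [x 0] (fun n => x (n + 1)) = x := by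
      funext n
      cases n <;> simp [appendSeq]
    cases hb : x 0 with
    | false => exact ⟨(none, fun n => x (n + 1)), by simpa [hb] using hx⟩
    | true =>
      obtain ⟨⟨i, y⟩, h⟩ := hw.2 fun n => x (n + 1)
      refine ⟨(some i, y), ?_⟩
      simp only [Option.elim, hcons]
      rw [← hb, ← hx]
      exact congrArg _ h

theorem exists_isCompletePrefixCode (ι : Type*) [Finite ι] [Nonempty ι] :
    ∃ w : ι → List Bool, IsCompletePrefixCode w := by
  suffices h : ∀ n, ∃ w : Fin (n + 1) → List Bool, IsCompletePrefixCode w by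
    obtain ⟨n, ⟨e⟩⟩ := Finite.exists_equiv_fin ι
    cases n with
    | zero => exact (e (Classical.arbitrary ι)).elim0
    | succ n =>
      obtain ⟨w, hw⟩ := h n
      exact ⟨_, hw.comp_equiv e⟩
  intro n
  induction n with
  | zero => exact ⟨_, isCompletePrefixCode_nil (ι := Fin 1)⟩
  | succ n ih =>
    obtain ⟨w, hw⟩ := ih
    exact ⟨_, hw.option.comp_equiv (finSuccEquiv (n + 1))⟩

theorem IsCompletePrefixCode.continuous_of_comp {ι : Type*} [Finite ι] {u v : ι → List Bool}
    (hu : IsCompletePrefixCode u) {f : Cantor → Cantor}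
    (hf : ∀ i y, f (appendSeq (u i) y) = appendSeq (v i) y) : Continuous f := by
  let : TopologicalSpace ι := ⊥
  have : DiscreteTopology ι := ⟨rfl⟩
  have hcont (w : ι → List Bool) :
      Continuous fun p : ι × Cantor => appendSeq (w p.1) p.2 :=
    continuous_prod_of_discrete_left.2 fun i => continuous_appendSeq (w i)
  have hquot := (hcont u).isClosedMap.isQuotientMap (hcont u) hu.2
  refine hquot.continuous_iff.2 ?_
  convert hcont v using 1
  exact funext fun p => hf p.1 p.2

theorem isPrefixExchange_iff (f : Cantor ≃ₜ Cantor) :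
    IsPrefixExchange f ↔ ∃ (n : ℕ) (u v : Fin n → List Bool),
      IsCompletePrefixCode u ∧ IsCompletePrefixCode v ∧
        ∀ i y, f (appendSeq (u i) y) = appendSeq (v i) y := by
  simp only [isCompletePrefixCode_iff]
  constructor
  · rintro ⟨n, -, u, v, hu, hu', hv, hv', h⟩
    exact ⟨n, u, v, ⟨hu, hu'⟩, ⟨hv, hv'⟩, h⟩
  · rintro ⟨n, u, v, ⟨hu, hu'⟩, ⟨hv, hv'⟩, h⟩
    refine ⟨n, ?_, u, v, hu, hu', hv, hv', h⟩
    obtain ⟨i, -⟩ := Set.mem_iUnion.1 (hu' ▸ Set.mem_univ fun _ => false)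
    exact i.pos

theorem isPrefixExchange_of_finite {ι : Type*} [Finite ι] {f : Cantor ≃ₜ Cantor}
    {u v : ι → List Bool} (hu : IsCompletePrefixCode u) (hv : IsCompletePrefixCode v)
    (hf : ∀ i y, f (appendSeq (u i) y) = appendSeq (v i) y) : IsPrefixExchange f := by
  obtain ⟨n, ⟨e⟩⟩ := Finite.exists_equiv_fin ι
  exact (isPrefixExchange_iff f).2
    ⟨n, _, _, hu.comp_equiv e.symm, hv.comp_equiv e.symm, fun i => hf (e.symm i)⟩

section InducedAction

variable {G : Type*} [Group G] (H : Subgroup G)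

/-- The cocycle `G × G ⧸ H → H` attached to the choice of coset representatives
`Quotient.out`. -/
noncomputable def cosetCocycle (g : G) (q : G ⧸ H) : H :=
  ⟨(g • q).out⁻¹ * (g * q.out), QuotientGroup.eq.1 <| by
    rw [QuotientGroup.out_eq', ← smul_eq_mul, ← MulAction.Quotient.smul_mk,
      QuotientGroup.out_eq']⟩

theorem cosetCocycle_one (q : G ⧸ H) : cosetCocycle H 1 q = 1 := by
  ext
  simp [cosetCocycle]

theorem cosetCocycle_mul (g g' : G) (q : G ⧸ H) :
    cosetCocycle H (g * g') q = cosetCocycle H g (g' • q) * cosetCocycle H g' q := by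
  ext
  simp [cosetCocycle, mul_smul, mul_assoc]

variable {H}

/-- The action of `G` on `G ⧸ H × X` induced from an action of `H` on `X`. -/
noncomputable def inducedPermHom {X : Type*} (φ : H →* Equiv.Perm X) :
    G →* Equiv.Perm ((G ⧸ H) × X) :=
  MonoidHom.toHomPerm
    { toFun := fun g p => (g • p.1, φ (cosetCocycle H g p.1) p.2)
      map_one' := by
        funext p
        simp only [one_smul, cosetCocycle_one, map_one, Equiv.Perm.one_apply]
        rfl
      map_mul' := fun g g' => by
        funext p
        simp only [cosetCocycle_mul, mul_smul, map_mul, Equiv.Perm.mul_apply]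
        rfl }

theorem inducedPermHom_apply {X : Type*} (φ : H →* Equiv.Perm X) (g : G) (q : G ⧸ H) (x : X) :
    inducedPermHom φ g (q, x) = (g • q, φ (cosetCocycle H g q) x) :=
  rfl

theorem inducedPermHom_injective {X : Type*} [Nonempty X] {φ : H →* Equiv.Perm X}
    (hφ : Function.Injective φ) : Function.Injective (inducedPermHom φ) := by
  refine (injective_iff_map_eq_one _).2 fun g hg => ?_
  have h (q : G ⧸ H) (x : X) : (g • q, φ (cosetCocycle H g q) x) = (q, x) := by
    rw [← inducedPermHom_apply, hg, Equiv.Perm.one_apply]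
  let q : G ⧸ H := ((1 : G) : G ⧸ H)
  have hc : cosetCocycle H g q = 1 :=
    (injective_iff_map_eq_one φ).1 hφ _ (Equiv.ext fun x => congrArg Prod.snd (h q x))
  have hq : g • q = q := congrArg Prod.fst (h q (Classical.arbitrary X))
  have := congrArg Subtype.val hc
  simpa [cosetCocycle, hq, inv_mul_eq_one] using this

end InducedAction

/-- The underlying permutation of a homeomorphism of the Cantor space. -/
def cantorToPerm : (Cantor ≃ₜ Cantor) →* Equiv.Perm Cantor where
  toFun f := f.toEquiv
  map_one' := rfl
  map_mul' _ _ := rfl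

theorem cantorToPerm_injective : Function.Injective cantorToPerm :=
  Homeomorph.toEquiv_injective

/-- If a subgroup `H` of finite index in `G` embeds into Thompson's group `V`
(realized as the prefix-exchange homeomorphisms of the Cantor space), then so
does `G`. -/
theorem finiteIndex_overgroup_embeds_in_V {G : Type*} [Group G] (H : Subgroup G)
    (hfin : H.FiniteIndex) (φ : H →* (Cantor ≃ₜ Cantor))
    (hφinj : Function.Injective φ)
    (hφpe : ∀ h : H, IsPrefixExchange (φ h)) :
    ∃ ψ : G →* (Cantor ≃ₜ Cantor),
      Function.Injective ψ ∧ ∀ g : G, IsPrefixExchange (ψ g) := by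
  have := hfin
  obtain ⟨w, hw⟩ := exists_isCompletePrefixCode (G ⧸ H)
  let E : (G ⧸ H) × Cantor ≃ Cantor := Equiv.ofBijective _ hw
  let P : G →* Equiv.Perm Cantor :=
    E.permCongrHom.toMonoidHom.comp (inducedPermHom (cantorToPerm.comp φ))
  have hP (g : G) (q : G ⧸ H) (y : Cantor) :
      P g (appendSeq (w q) y) = appendSeq (w (g • q)) (φ (cosetCocycle H g q) y) := by
    change E (inducedPermHom (cantorToPerm.comp φ) g (E.symm (E (q, y)))) = _
    rw [Equiv.symm_apply_apply, inducedPermHom_apply]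
    rfl
  choose n u v hu hv huv using fun h => (isPrefixExchange_iff _).1 (hφpe h)
  let U (g : G) (p : Σ q : G ⧸ H, Fin (n (cosetCocycle H g q))) : List Bool :=
    w p.1 ++ u _ p.2
  let V (g : G) (p : Σ q : G ⧸ H, Fin (n (cosetCocycle H g q))) : List Bool :=
    w (g • p.1) ++ v _ p.2
  have hU (g : G) : IsCompletePrefixCode (U g) := hw.sigma fun _ => hu _
  have hV (g : G) : IsCompletePrefixCode (V g) :=
    (hw.comp_equiv (MulAction.toPerm g)).sigma fun _ => hv _
  have hUV (g : G) (p) (y : Cantor) : P g (appendSeq (U g p) y) = appendSeq (V g p) y := by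
    simp only [U, V, appendSeq_append, hP, huv]
  have hcont (g : G) : Continuous (P g) := (hU g).continuous_of_comp (hUV g)
  refine ⟨{ toFun := fun g => ⟨P g, hcont g, ?_⟩, map_one' := ?_, map_mul' := ?_ }, ?_, ?_⟩
  · have h := hcont g⁻¹
    rwa [map_inv] at h
  · exact cantorToPerm_injective P.map_one
  · exact fun g g' => cantorToPerm_injective (P.map_mul g g')
  · intro g g' h
    have hPP : P g = P g' := congrArg cantorToPerm h
    exact inducedPermHom_injective (cantorToPerm_injective.comp hφinj)
      (E.permCongrHom.injective hPP)
  · exact fun g => isPrefixExchange_of_finite (hU g) (hV g) (hUV g)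
end

section
/- For any alphabet Σ and any language L ⊆ List Σ: if L is context-free, then its cyclic shift L° := {v ++ u : u, v ∈ List Σ, u ++ v ∈ L} is context-free. -/
namespace ContextFreeGrammar

variable {T : Type}

/-- Nonterminals of the grammar for the cyclic shift: a fresh start symbol, a copy `plain A` of
every nonterminal `A`, and a nonterminal `outer A` that generates the words `z ++ y` such that
`y A z` is derivable from the initial symbol. -/
inductive CyclicNT (N : Type)
  | start : CyclicNT N
  | plain : N → CyclicNT N
  | outer : N → CyclicNT N

/-- Embedding of the symbols of a grammar into those of its cyclic shift. -/
def liftSymbol {N : Type} : Symbol T N → Symbol T (CyclicNT N)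
  | .terminal t => .terminal t
  | .nonterminal n => .nonterminal (.plain n)

/-- Embedding of the sentential forms of a grammar into those of its cyclic shift. -/
abbrev lift {N : Type} (s : List (Symbol T N)) : List (Symbol T (CyclicNT N)) :=
  s.map liftSymbol

/-- Rules of the grammar for the cyclic shift of the language of `g`. -/
inductive CyclicRule (g : ContextFreeGrammar T) : ContextFreeRule T (CyclicNT g.NT) → Prop
  | plain (r : ContextFreeRule T g.NT) (hr : r ∈ g.rules) :
      CyclicRule g ⟨.plain r.input, lift r.output⟩
  | root : CyclicRule g ⟨.outer g.initial, []⟩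
  | outer (r : ContextFreeRule T g.NT) (hr : r ∈ g.rules) (a b : List (Symbol T g.NT)) (n : g.NT)
      (ho : r.output = a ++ .nonterminal n :: b) :
      CyclicRule g ⟨.outer n, lift b ++ .nonterminal (.outer r.input) :: lift a⟩
  | cut (r : ContextFreeRule T g.NT) (hr : r ∈ g.rules) (a b : List (Symbol T g.NT))
      (ho : r.output = a ++ b) :
      CyclicRule g ⟨.start, lift b ++ .nonterminal (.outer r.input) :: lift a⟩
  | start : CyclicRule g ⟨.start, [.nonterminal (.plain g.initial)]⟩

lemma finite_cyclicRule (g : ContextFreeGrammar T) : {r | CyclicRule g r}.Finite := by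
  have key : ∀ r : ContextFreeRule T g.NT,
      {p : List (Symbol T g.NT) × List (Symbol T g.NT) | r.output = p.1 ++ p.2}.Finite := by
    intro r
    refine ((Set.finite_Iic r.output.length).image
      fun k ↦ (r.output.take k, r.output.drop k)).subset ?_
    rintro ⟨a, b⟩ (h : r.output = a ++ b)
    exact ⟨a.length, by simp [h], by simp [h]⟩
  have hplain := g.rules.finite_toSet.image
    fun r ↦ (⟨.plain r.input, lift r.output⟩ : ContextFreeRule T (CyclicNT g.NT))
  have hcut := g.rules.finite_toSet.biUnion fun r _ ↦ (key r).image fun p ↦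
    (⟨.start, lift p.2 ++ .nonterminal (.outer r.input) :: lift p.1⟩ :
      ContextFreeRule T (CyclicNT g.NT))
  have houter := g.rules.finite_toSet.biUnion fun r _ ↦ (key r).image fun p ↦
    match p.2 with
    | Symbol.nonterminal n :: b =>
      (⟨.outer n, lift b ++ Symbol.nonterminal (CyclicNT.outer r.input) :: lift p.1⟩ :
        ContextFreeRule T (CyclicNT g.NT))
    | _ => ⟨.start, []⟩
  refine (((hplain.union hcut).union houter).union
    (Set.toFinite {⟨.outer g.initial, []⟩, ⟨.start, [.nonterminal (.plain g.initial)]⟩})).subset ?_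
  rintro _ (⟨r, hr⟩ | _ | ⟨r, hr, a, b, n, ho⟩ | ⟨r, hr, a, b, ho⟩ | _)
  · exact .inl (.inl (.inl ⟨r, hr, rfl⟩))
  · exact .inr (.inl rfl)
  · exact .inl (.inr (Set.mem_biUnion hr ⟨(a, Symbol.nonterminal n :: b), ho, rfl⟩))
  · exact .inl (.inl (.inr (Set.mem_biUnion hr ⟨(a, b), ho, rfl⟩)))
  · exact .inr (.inr rfl)

/-- A grammar for the cyclic shift of the language of `g`. -/
noncomputable abbrev cyclicShift (g : ContextFreeGrammar T) : ContextFreeGrammar T where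
  NT := CyclicNT g.NT
  initial := .start
  rules := g.finite_cyclicRule.toFinset

variable {g : ContextFreeGrammar T}

lemma append_cons_eq_append {α : Type*} {x : α} {a b c d : List α} (h : a ++ x :: b = c ++ d) :
    (∃ e, c = a ++ x :: e ∧ b = e ++ d) ∨ ∃ e, a = c ++ e ∧ d = e ++ x :: b := by
  obtain ⟨e, rfl, he⟩ | ⟨e, rfl, he⟩ := List.append_eq_append_iff.1 h
  · cases e with
    | nil => exact .inr ⟨[], by simp, he.symm⟩
    | cons y e =>
      obtain ⟨rfl, rfl⟩ := List.cons.inj he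
      exact .inl ⟨e, rfl, rfl⟩
  · exact .inr ⟨e, rfl, he⟩

lemma produces_of_rule {r : ContextFreeRule T g.NT} (hr : r ∈ g.rules)
    (p q : List (Symbol T g.NT)) :
    g.Produces (p ++ .nonterminal r.input :: q) (p ++ r.output ++ q) :=
  ⟨r, hr, by simpa using r.rewrites_of_exists_parts p q⟩

lemma Produces.exists_rule {u v : List (Symbol T g.NT)} (h : g.Produces u v) :
    ∃ r ∈ g.rules, ∃ p q, u = p ++ .nonterminal r.input :: q ∧ v = p ++ r.output ++ q := by
  obtain ⟨r, hr, h⟩ := h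
  obtain ⟨p, q, hu, hv⟩ := h.exists_parts
  exact ⟨r, hr, p, q, by simpa using hu, hv⟩

lemma CyclicRule.produces {n : CyclicNT g.NT} {o : List (Symbol T (CyclicNT g.NT))}
    (h : CyclicRule g ⟨n, o⟩) (p q : List (Symbol T (CyclicNT g.NT))) :
    g.cyclicShift.Produces (p ++ .nonterminal n :: q) (p ++ o ++ q) :=
  produces_of_rule (g := g.cyclicShift) (r := ⟨n, o⟩) (g.finite_cyclicRule.mem_toFinset.2 h) p q

lemma lift_eq_append_cons {N : Type} {s : List (Symbol T N)}
    {p q : List (Symbol T (CyclicNT N))} {n : CyclicNT N}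
    (h : lift s = p ++ .nonterminal n :: q) :
    ∃ a b m, s = a ++ .nonterminal m :: b ∧ p = lift a ∧ q = lift b ∧ n = .plain m := by
  obtain ⟨a, c, rfl, rfl, hc⟩ := List.map_eq_append_iff.1 h
  obtain ⟨x, b, rfl, hx, rfl⟩ := List.map_eq_cons_iff.1 hc
  cases x with
  | terminal t => simp [liftSymbol] at hx
  | nonterminal m =>
    simp only [liftSymbol, Symbol.nonterminal.injEq] at hx
    exact ⟨a, b, m, rfl, rfl, rfl, hx.symm⟩

lemma derives_outer {s : List (Symbol T g.NT)} (h : g.Derives [.nonterminal g.initial] s) :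
    ∀ a n b, s = a ++ .nonterminal n :: b →
      g.cyclicShift.Derives [.nonterminal (.outer n)] (lift b ++ lift a) := by
  induction h with
  | refl =>
    intro a n b h
    obtain ⟨rfl, rfl, rfl⟩ : a = [] ∧ n = g.initial ∧ b = [] := by
      cases a <;> simp_all
    simpa using (CyclicRule.root.produces (g := g) [] []).single
  | tail _ hst ih =>
    intro a n b h
    obtain ⟨r, hr, p, q, rfl, rfl⟩ := hst.exists_rule
    have hC := CyclicRule.plain r hr
    rw [List.append_assoc] at h
    obtain ⟨c, rfl, rfl⟩ | ⟨c, rfl, h'⟩ := append_cons_eq_append h.symm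
    · refine (ih a n (c ++ .nonterminal r.input :: q) (by simp)).trans ?_
      simpa [liftSymbol] using (hC.produces (lift c) (lift q ++ lift a)).single
    · obtain ⟨d, ho, rfl⟩ | ⟨d, rfl, rfl⟩ := append_cons_eq_append h'.symm
      · have h1 := (CyclicRule.outer r hr _ _ _ ho).produces [] []
        have h2 := ((ih p r.input q rfl).append_left (lift d)).append_right (lift c)
        simp only [List.nil_append, List.append_nil] at h1
        simpa using h1.trans_derives (by simpa using h2)
      · refine (ih (p ++ .nonterminal r.input :: d) n b (by simp)).trans ?_
        simpa [liftSymbol] using (hC.produces (lift b ++ lift p) (lift d)).single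

lemma derives_start {s : List (Symbol T g.NT)} (h : g.Derives [.nonterminal g.initial] s) :
    ∀ a b, s = a ++ b →
      g.cyclicShift.Derives [.nonterminal .start] (lift b ++ lift a) := by
  induction h with
  | refl =>
    intro a b h
    have : lift b ++ lift a = [.nonterminal (.plain g.initial)] := by
      cases a <;> simp_all [liftSymbol, eq_comm]
    rw [this]
    simpa using (CyclicRule.start.produces (g := g) [] []).single
  | tail hs hst ih =>
    intro a b h
    obtain ⟨r, hr, p, q, rfl, rfl⟩ := hst.exists_rule
    have hC := CyclicRule.plain r hr
    rw [List.append_assoc] at h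
    obtain ⟨c, rfl, h'⟩ | ⟨c, rfl, rfl⟩ := List.append_eq_append_iff.1 h
    · obtain ⟨d, rfl, rfl⟩ | ⟨d, ho, rfl⟩ := List.append_eq_append_iff.1 h'
      · refine (ih (p ++ .nonterminal r.input :: d) b (by simp)).trans ?_
        simpa [liftSymbol] using (hC.produces (lift b ++ lift p) (lift d)).single
      · have h1 := (CyclicRule.cut r hr _ _ ho).produces [] []
        have h2 := ((derives_outer hs p r.input q rfl).append_left (lift d)).append_right (lift c)
        simp only [List.nil_append, List.append_nil] at h1
        simpa using h1.trans_derives (by simpa using h2)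
    · refine (ih a (c ++ .nonterminal r.input :: q) (by simp)).trans ?_
      simpa [liftSymbol] using (hC.produces (lift c) (lift q ++ lift a)).single

/-- The sentential forms derivable in the grammar for the cyclic shift. -/
inductive CyclicForm (g : ContextFreeGrammar T) : List (Symbol T (CyclicNT g.NT)) → Prop
  | start : CyclicForm g [.nonterminal .start]
  | outer (a b : List (Symbol T g.NT)) (n : g.NT) (h : g.Derives [.nonterminal n] (a ++ b)) :
      CyclicForm g (lift b ++ .nonterminal (.outer n) :: lift a)
  | plain (a b : List (Symbol T g.NT)) (h : g.Derives [.nonterminal g.initial] (a ++ b)) :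
      CyclicForm g (lift b ++ lift a)

lemma CyclicForm.rewrite {p q o : List (Symbol T (CyclicNT g.NT))} {n : CyclicNT g.NT}
    (hs : CyclicForm g (p ++ .nonterminal n :: q)) (hr : CyclicRule g ⟨n, o⟩) :
    CyclicForm g (p ++ o ++ q) := by
  generalize hu : p ++ .nonterminal n :: q = u at hs
  cases hs with
  | start =>
    obtain ⟨rfl, rfl, rfl⟩ : p = [] ∧ n = .start ∧ q = [] := by
      cases p <;> simp_all
    cases hr with
    | cut r hr a b ho =>
      simpa using CyclicForm.outer a b r.input 
        (ho ▸ by simpa using (produces_of_rule hr [] []).single)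
    | start => simpa [liftSymbol] using CyclicForm.plain [] [.nonterminal g.initial] (.refl _)
  | outer a b m h =>
    obtain ⟨c, hb, rfl⟩ | ⟨c, rfl, hc⟩ := append_cons_eq_append hu
    · obtain ⟨b₁, b₂, k, rfl, rfl, rfl, rfl⟩ := lift_eq_append_cons hb
      cases hr with
      | plain r hr =>
        simpa using CyclicForm.outer a (b₁ ++ r.output ++ b₂) m
          (h.trans_produces (by simpa using produces_of_rule hr (a ++ b₁) b₂))
    · cases c with
      | nil =>
        simp only [List.nil_append, List.cons.injEq, Symbol.nonterminal.injEq] at hc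
        obtain ⟨rfl, rfl⟩ := hc
        cases hr with
        | root => simpa using CyclicForm.plain a b h
        | outer r hr c d _ ho =>
          have h1 := produces_of_rule hr [] []
          have h2 := (h.append_left c).append_right d
          simp only [List.nil_append, List.append_nil, ho] at h1
          simpa using CyclicForm.outer (c ++ a) (b ++ d) r.input
            (h1.trans_derives (by simpa using h2))
      | cons x c =>
        simp only [List.cons_append, List.cons.injEq] at hc
        obtain ⟨rfl, hc⟩ := hc
        obtain ⟨a₁, a₂, k, rfl, rfl, rfl, rfl⟩ := lift_eq_append_cons hc
        cases hr with
        | plain r hr =>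
          simpa using CyclicForm.outer (a₁ ++ r.output ++ a₂) b m
            (h.trans_produces (by simpa using produces_of_rule hr a₁ (a₂ ++ b)))
  | plain a b h =>
    obtain ⟨c, hb, rfl⟩ | ⟨c, rfl, hc⟩ := append_cons_eq_append hu
    · obtain ⟨b₁, b₂, k, rfl, rfl, rfl, rfl⟩ := lift_eq_append_cons hb
      cases hr with
      | plain r hr =>
        simpa using CyclicForm.plain a (b₁ ++ r.output ++ b₂)
          (h.trans_produces (by simpa using produces_of_rule hr (a ++ b₁) b₂))
    · obtain ⟨a₁, a₂, k, rfl, rfl, rfl, rfl⟩ := lift_eq_append_cons hc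
      cases hr with
      | plain r hr =>
        simpa using CyclicForm.plain (a₁ ++ r.output ++ a₂) b
          (h.trans_produces (by simpa using produces_of_rule hr a₁ (a₂ ++ b)))

lemma Derives.cyclicForm {s : List (Symbol T (CyclicNT g.NT))}
    (h : g.cyclicShift.Derives [.nonterminal .start] s) : CyclicForm g s := by
  induction h with
  | refl => exact .start
  | tail _ hst ih =>
    obtain ⟨r, hr, p, q, rfl, rfl⟩ := hst.exists_rule
    exact ih.rewrite (g.finite_cyclicRule.mem_toFinset.1 hr)

lemma lift_map_terminal {N : Type} (w : List T) :
    lift (w.map (.terminal : T → Symbol T N)) = w.map .terminal := by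
  simp [liftSymbol]

lemma eq_map_terminal_of_lift {N : Type} {s : List (Symbol T N)} {w : List T}
    (h : lift s = w.map .terminal) : s = w.map .terminal := by
  rw [← lift_map_terminal] at h
  refine List.map_injective_iff.2 ?_ h
  rintro (_ | _) (_ | _) h <;> simp_all [liftSymbol]

theorem language_cyclicShift (g : ContextFreeGrammar T) :
    g.cyclicShift.language = {w : List T | ∃ u v : List T, w = v ++ u ∧ u ++ v ∈ g.language} := by
  ext w
  constructor
  · intro h
    have hw := Derives.cyclicForm h
    generalize hs : w.map Symbol.terminal = s at hw
    cases hw with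
    | start => cases w <;> simp at hs
    | outer a b n =>
      have : Symbol.nonterminal (CyclicNT.outer n) ∈ w.map Symbol.terminal := by simp [hs]
      simp at this
    | plain a b hab =>
      obtain ⟨v, u, rfl, hv, hu⟩ := List.map_eq_append_iff.1 hs
      refine ⟨u, v, rfl, ?_⟩
      rw [eq_map_terminal_of_lift hu.symm, eq_map_terminal_of_lift hv.symm] at hab
      simpa using hab
  · rintro ⟨u, v, rfl, h⟩
    have := derives_start h (u.map .terminal) (v.map .terminal) (by simp)
    rw [lift_map_terminal, lift_map_terminal] at this
    simpa using this

end ContextFreeGrammar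

/-- The class of context-free languages is closed under cyclic shift: if `L` is
context-free, then so is `L° = {v ++ u : u ++ v ∈ L}`. -/
theorem contextFree_cyclicShift {T : Type} (L : Language T)
    (hL : L.IsContextFree) :
    Language.IsContextFree
      {w : List T | ∃ u v : List T, w = v ++ u ∧ u ++ v ∈ L} := by
  obtain ⟨g, rfl⟩ := hL
  exact ⟨g.cyclicShift, g.language_cyclicShift⟩
end
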